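/- arXiv:2101.01137 — 5 statements merged into one kernel-verified Lean document; each statement's English description precedes it below -/
import Mathlib

section
/- Let n ≥ 2 be an integer and let Σ₀ and Σ₁ be n×n real symmetric positive definite matrices such that (1 − 1/n)·Σ₀ ≼ Σ₁ ≼ (1 + 1/n)·Σ₀ in the Loewner order. Then (1/2)·Tr(Σ₁⁻¹ Σ₀) + (1/2)·(log det Σ₁ − log det Σ₀) − n/2 ≤ (n/2)·(1/(n−1) + log(1 + 1/n)). -/
open Matrix

open scoped MatrixOrder Matrix.Norms.L2Operator in
lemma klaux_fac {n : ℕ} {B : Matrix (Fin n) (Fin n) ℝ} (hB : B.PosSemidef) :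
    ∃ R : Matrix (Fin n) (Fin n) ℝ, B = Rᴴ * R :=
  CStarAlgebra.nonneg_iff_eq_star_mul_self.mp hB.nonneg

lemma klaux_trace {n : ℕ} {A B : Matrix (Fin n) (Fin n) ℝ} (hA : A.PosSemidef)
    (hB : B.PosSemidef) : 0 ≤ (B * A).trace := by
  obtain ⟨R, rfl⟩ := klaux_fac hB
  rw [Matrix.mul_assoc, Matrix.trace_mul_comm]
  exact (hA.mul_mul_conjTranspose_same R).trace_nonneg

lemma klaux_det {n : ℕ} {A B : Matrix (Fin n) (Fin n) ℝ} (hA : A.PosDef)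
    (hB : B.PosDef) {c : ℝ} (hc : 0 < c) :
    Real.log (B.det * A.det) ≤ (B * A).trace / c - n + n * Real.log c := by
  have hpos := mul_pos hB.det_pos hA.det_pos
  obtain ⟨R, rfl⟩ := klaux_fac hB.posSemidef
  have hM := hA.posSemidef.mul_mul_conjTranspose_same R
  have hd : (Rᴴ * R).det * A.det = (R * A * Rᴴ).det := by
    simp only [Matrix.det_mul]; ring
  have ht : (Rᴴ * R * A).trace = (R * A * Rᴴ).trace := by
    rw [Matrix.mul_assoc, Matrix.trace_mul_comm]
  rw [hd] at hpos ⊢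
  rw [ht]
  have hPD : (R * A * Rᴴ).PosDef := hM.posDef_iff_det_ne_zero.2 hpos.ne'
  have e1 := hPD.1.det_eq_prod_eigenvalues
  have e2 := hPD.1.trace_eq_sum_eigenvalues
  simp only [RCLike.ofReal_real_eq_id, id_eq] at e1 e2
  rw [e1, e2, Real.log_prod (fun i _ => (hPD.eigenvalues_pos i).ne')]
  have : ∀ i, Real.log (hPD.1.eigenvalues i) ≤ hPD.1.eigenvalues i / c - 1 + Real.log c := by
    intro i
    have hi := hPD.eigenvalues_pos i
    have := Real.log_le_sub_one_of_pos (div_pos hi hc)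
    rw [Real.log_div hi.ne' hc.ne'] at this
    linarith
  refine (Finset.sum_le_sum fun i _ => this i).trans (le_of_eq ?_)
  simp [Finset.sum_add_distrib, Finset.sum_sub_distrib, Finset.sum_div]

/-- KL-divergence bound: if `Σ₀, Σ₁` are `n × n` real symmetric positive definite matrices
(`n ≥ 2`) with `(1 - 1/n) • Σ₀ ≼ Σ₁ ≼ (1 + 1/n) • Σ₀` in the Loewner order, then
`½ Tr(Σ₁⁻¹ Σ₀) + ½ (log det Σ₁ - log det Σ₀) - n/2 ≤ (n/2) (1/(n-1) + log (1 + 1/n))`. -/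
theorem kl_divergence_bound_of_loewner
    (n : ℕ) (hn : 2 ≤ n) (S₀ S₁ : Matrix (Fin n) (Fin n) ℝ)
    (hS₀ : S₀.PosDef) (hS₁ : S₁.PosDef)
    (h₁ : (S₁ - (1 - (n : ℝ)⁻¹) • S₀).PosSemidef)
    (h₂ : ((1 + (n : ℝ)⁻¹) • S₀ - S₁).PosSemidef) :
    (1 / 2) * (S₁⁻¹ * S₀).trace
        + (1 / 2) * (Real.log S₁.det - Real.log S₀.det) - (n : ℝ) / 2
      ≤ ((n : ℝ) / 2) * (((n : ℝ) - 1)⁻¹ + Real.log (1 + (n : ℝ)⁻¹)) := by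
  have hn' : (2 : ℝ) ≤ n := by exact_mod_cast hn
  have hc : 0 < 1 + (n : ℝ)⁻¹ := by positivity
  have t1 := klaux_trace h₁ hS₁.inv.posSemidef
  have t2 := klaux_trace h₂ hS₀.inv.posSemidef
  have d := klaux_det hS₁ hS₀.inv hc
  have u1 : IsUnit S₁.det := hS₁.det_pos.ne'.isUnit
  have u0 : IsUnit S₀.det := hS₀.det_pos.ne'.isUnit
  rw [Matrix.mul_sub, Matrix.mul_smul, Matrix.trace_sub, Matrix.trace_smul,
    Matrix.nonsing_inv_mul _ u1, Matrix.trace_one, Fintype.card_fin, smul_eq_mul] at t1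
  rw [Matrix.mul_sub, Matrix.mul_smul, Matrix.trace_sub, Matrix.trace_smul,
    Matrix.nonsing_inv_mul _ u0, Matrix.trace_one, Fintype.card_fin, smul_eq_mul] at t2
  rw [Matrix.det_nonsing_inv, Ring.inverse_eq_inv', Real.log_mul
    (inv_ne_zero hS₀.det_pos.ne') hS₁.det_pos.ne', Real.log_inv] at d
  have t2' : (S₀⁻¹ * S₁).trace / (1 + (n : ℝ)⁻¹) ≤ n := by
    rw [div_le_iff₀ hc]; linarith
  have t1' : (S₁⁻¹ * S₀).trace ≤ n + n * ((n : ℝ) - 1)⁻¹ := by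
    have hp : 0 < 1 - (n : ℝ)⁻¹ := by
      have : (n : ℝ)⁻¹ < 1 := inv_lt_one_of_one_lt₀ (by linarith)
      linarith
    have hn1 : (n : ℝ) - 1 ≠ 0 := by linarith
    have hn0 : (n : ℝ) ≠ 0 := by linarith
    have e : (n + n * ((n : ℝ) - 1)⁻¹) * (1 - (n : ℝ)⁻¹) = n := by
      field_simp
      ring
    refine le_of_mul_le_mul_right ?_ hp
    rw [e]; linarith
  linarith
end

section
/- Let d ≥ 1 be an integer, let r > d/2 be a real number, let L₁, …, L_d > 0 and U₁, …, U_d > 0 and B, C > 0 be real numbers, and set m := min_{1≤k≤d} L_k U_k. Let f : ℝᵈ → ℝ be measurable with 0 ≤ f(η) ≤ B for all η ∈ ℝᵈ, and let p : ℝᵈ → ℝ be measurable with 0 ≤ p(η) ≤ C·(1 + Σ_{k=1}^{d} L_k² η_k²)^{−r} for all η. Then the integral of f·p over the tail region T_U := {η ∈ ℝᵈ : |η_k| ≥ U_k for all k = 1, …, d} satisfies ∫_{T_U} f(η) p(η) dη ≤ (B·C / Π_{k=1}^{d} L_k) · (2 π^{d/2} / Γ(d/2)) · ∫_{m}^{∞}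 t^{d−1} (1 + t²)^{−r} dt, where Γ is the Gamma function. -/
open MeasureTheory Finset Real

lemma aux_radial (d : ℕ) (hd : 1 ≤ d) (g : ℝ → ℝ) :
    ∫ x : Fin d → ℝ, g ‖WithLp.toLp 2 x‖ =
      (2 * π ^ ((d : ℝ) / 2) / Real.Gamma ((d : ℝ) / 2)) *
        ∫ t in Set.Ioi (0:ℝ), t ^ (d - 1) * g t := by
  haveI : Nonempty (Fin d) := ⟨⟨0, hd⟩⟩
  have h1 := (PiLp.volume_preserving_toLp (Fin d)).integral_comp
    (MeasurableEquiv.toLp 2 (Fin d → ℝ)).measurableEmbedding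
    (fun x : EuclideanSpace ℝ (Fin d) => g ‖x‖)
  rw [h1, integral_fun_norm_addHaar]
  simp only [finrank_euclideanSpace, Fintype.card_fin, nsmul_eq_mul, smul_eq_mul]
  rw [Measure.real, EuclideanSpace.volume_ball, ← mul_assoc]
  congr 1
  have hd' : (0:ℝ) < d := by exact_mod_cast hd
  have hG : 0 < Real.Gamma ((d:ℝ)/2) := Real.Gamma_pos_of_pos (by positivity)
  simp only [Fintype.card_fin, ENNReal.ofReal_one, one_pow, one_mul]
  rw [Real.Gamma_add_one (by positivity), ENNReal.toReal_ofReal (by positivity)]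
  have : √π ^ d = π ^ ((d:ℝ)/2) := by
    rw [Real.sqrt_eq_rpow, ← Real.rpow_natCast, ← Real.rpow_mul pi_pos.le]
    congr 1; ring
  rw [this]
  field_simp

lemma aux_map (d : ℕ) (L : Fin d → ℝ) (hL : ∀ k, 0 < L k) (h : (Fin d → ℝ) → ℝ)
    (hi : Integrable h) :
    Integrable (fun x : Fin d → ℝ => h (fun k => L k * x k)) ∧
    ∫ x : Fin d → ℝ, h (fun k => L k * x k) = (∏ k, L k)⁻¹ * ∫ x, h x := by
  have hP : 0 < ∏ k, L k := Finset.prod_pos fun k _ => hL k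
  have hdet : Matrix.det (Matrix.diagonal L) = ∏ k, L k := Matrix.det_diagonal
  have key := Real.smul_map_diagonal_volume_pi (D := L) (by rw [hdet]; exact hP.ne')
  rw [hdet, abs_of_pos hP] at key
  have hfun : (Matrix.toLin' (Matrix.diagonal L) : (Fin d → ℝ) → (Fin d → ℝ))
      = fun x k => L k * x k := by
    ext x k
    simp [Matrix.mulVec_diagonal]
  rw [hfun] at key
  have hm : Measurable (fun (x : Fin d → ℝ) k => L k * x k) := by fun_prop
  set ν := Measure.map (fun (x : Fin d → ℝ) k => L k * x k) volume with hν
  have hne : ENNReal.ofReal (∏ k, L k) ≠ 0 := by simpa using hP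
  have hi' : Integrable h ν := by
    rw [← key] at hi
    exact (integrable_smul_measure hne ENNReal.ofReal_ne_top).1 hi
  constructor
  · exact hi'.comp_measurable hm
  · have e1 : ∫ x, h x = (∏ k, L k) * ∫ x, h x ∂ν := by
      conv_lhs => rw [← key]
      rw [integral_smul_measure, ENNReal.toReal_ofReal hP.le, smul_eq_mul]
    have e2 : ∫ x, h x ∂ν = ∫ x : Fin d → ℝ, h (fun k => L k * x k) :=
      integral_map hm.aemeasurable hi'.aestronglyMeasurable
    rw [e1, e2, inv_mul_cancel_left₀ hP.ne']



/-- Truncation bound for the Matérn-type decay class `P^{(r)}_{C,L}` with `r > d/2`: if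
`0 ≤ f ≤ B` and `0 ≤ p(η) ≤ C (1 + ∑ₖ Lₖ² ηₖ²)^{-r}`, then with `m := minₖ Lₖ Uₖ`, the
integral of `f·p` over the tail region `{η : ∀ k, |ηₖ| ≥ Uₖ}` is at most
`(B C / ∏ₖ Lₖ) (2 π^{d/2} / Γ(d/2)) ∫ₘ^∞ t^{d-1} (1 + t²)^{-r} dt`. -/
theorem tail_integral_bound_matern_decay
    (d : ℕ) (hd : 1 ≤ d) (r : ℝ) (hr : (d : ℝ) / 2 < r)
    (L U : Fin d → ℝ) (hL : ∀ k, 0 < L k) (hU : ∀ k, 0 < U k)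
    (B C : ℝ) (hB : 0 < B) (hC : 0 < C)
    (f p : (Fin d → ℝ) → ℝ) (hf : Measurable f) (hp : Measurable p)
    (hf0 : ∀ η, 0 ≤ f η) (hfB : ∀ η, f η ≤ B)
    (hp0 : ∀ η, 0 ≤ p η)
    (hpC : ∀ η, p η ≤ C * (1 + ∑ k, (L k) ^ 2 * (η k) ^ 2) ^ (-r)) :
    ∫ η in {η : Fin d → ℝ | ∀ k, U k ≤ |η k|}, f η * p η
      ≤ (B * C / ∏ k, L k) * (2 * π ^ ((d : ℝ) / 2) / Real.Gamma ((d : ℝ) / 2))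
          * ∫ t in Set.Ioi (⨅ k, L k * U k), t ^ (d - 1) * (1 + t ^ 2) ^ (-r) := by
  haveI : Nonempty (Fin d) := ⟨⟨0, hd⟩⟩
  set m := ⨅ k, L k * U k with hm
  have hmle : ∀ k, m ≤ L k * U k := fun k => ciInf_le (Set.finite_range _).bddBelow k
  have hm0 : 0 < m := by
    obtain ⟨k, hk⟩ := exists_eq_ciInf_of_finite (f := fun k => L k * U k)
    rw [hm, ← hk]
    exact mul_pos (hL k) (hU k)
  set g : ℝ → ℝ := (Set.Ici m).indicator (fun t => (1 + t ^ 2) ^ (-r)) with hg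
  have hgi : Integrable (fun x : Fin d → ℝ => g ‖WithLp.toLp 2 x‖) := by
    have h0 : Integrable (fun x : EuclideanSpace ℝ (Fin d) => (1 + ‖x‖ ^ 2) ^ (-(2 * r) / 2)) :=
      integrable_rpow_neg_one_add_norm_sq (by
        simp only [finrank_euclideanSpace, Fintype.card_fin]; linarith)
    have h1 : Integrable (fun x : EuclideanSpace ℝ (Fin d) => g ‖x‖) := by
      have := h0.indicator (s := {x | m ≤ ‖x‖}) (measurableSet_le measurable_const measurable_norm)
      refine this.congr (Filter.Eventually.of_forall fun x => ?_)
      simp only [hg, Set.indicator, Set.mem_setOf_eq, Set.mem_Ici]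
      rw [show -(2 * r) / 2 = -r by ring]
    exact (PiLp.volume_preserving_toLp (Fin d)).integrable_comp_of_integrable h1
  obtain ⟨hi, he⟩ := aux_map d L hL _ hgi
  rw [aux_radial d hd] at he
  have hI : ∫ t in Set.Ioi (0:ℝ), t ^ (d - 1) * g t
      = ∫ t in Set.Ioi m, t ^ (d - 1) * (1 + t ^ 2) ^ (-r) := by
    have : (fun t => t ^ (d - 1) * g t) =
        (Set.Ici m).indicator (fun t => t ^ (d - 1) * (1 + t ^ 2) ^ (-r)) := by
      ext t
      simp only [hg, Set.indicator]
      split_ifs <;> simp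
    rw [this, setIntegral_indicator measurableSet_Ici, Set.inter_eq_right.2,
      integral_Ici_eq_integral_Ioi]
    intro t ht
    exact lt_of_lt_of_le hm0 ht
  rw [hI] at he
  have hT : MeasurableSet {η : Fin d → ℝ | ∀ k, U k ≤ |η k|} := by
    rw [Set.setOf_forall]
    exact MeasurableSet.iInter fun k => measurableSet_le measurable_const
      (by fun_prop)
  rw [← integral_indicator hT]
  have hg0 : ∀ t, 0 ≤ g t := fun t => Set.indicator_nonneg (fun t _ => by positivity) t
  calc _ ≤ ∫ η : Fin d → ℝ, (B * C) * g ‖WithLp.toLp 2 (fun k => L k * η k)‖ := by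
        refine integral_mono_of_nonneg (Filter.Eventually.of_forall fun η => ?_)
          (hi.const_mul _) (Filter.Eventually.of_forall fun η => ?_)
        · exact Set.indicator_nonneg (fun η _ => mul_nonneg (hf0 η) (hp0 η)) η
        · refine Set.indicator_le' (f := fun η => f η * p η) (g := fun η : Fin d → ℝ => (B * C) * g ‖WithLp.toLp 2 (fun k => L k * η k)‖) (fun η hη => ?_) (fun η _ => mul_nonneg (by positivity) (hg0 _)) η
          have hn : ‖WithLp.toLp 2 (fun k => L k * η k)‖ ^ 2 = ∑ k, (L k) ^ 2 * (η k) ^ 2 := by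
            rw [EuclideanSpace.norm_sq_eq]
            simp [mul_pow]
          have hmn : m ≤ ‖WithLp.toLp 2 (fun k => L k * η k)‖ := by
            have k : Fin d := ⟨0, hd⟩
            have h1 := PiLp.norm_apply_le (WithLp.toLp 2 (fun k => L k * η k)) k
            refine (hmle k).trans (le_trans ?_ h1)
            simp only [Real.norm_eq_abs, abs_mul, abs_of_pos (hL k)]
            exact mul_le_mul_of_nonneg_left (hη k) (hL k).le
          have : g ‖WithLp.toLp 2 (fun k => L k * η k)‖
              = (1 + ∑ k, (L k) ^ 2 * (η k) ^ 2) ^ (-r) := by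
            rw [hg, Set.indicator_of_mem (by exact hmn), hn]
          rw [this, mul_assoc]
          exact mul_le_mul (hfB η) (hpC η) (hp0 η) hB.le
    _ = _ := by
        rw [integral_const_mul, he]
        ring
end

section
/- Let n, s ≥ 1 be integers, let Z be an n×s complex matrix, let W be an s×s diagonal matrix with positive real diagonal entries, let σ_f, σₙ > 0, and let y ∈ ℂⁿ. Define K̃ := σ_f² Z W Z* + σₙ² Iₙ and w := W⁻¹ (σ_f² Z* Z + σₙ² W⁻¹)⁻¹ Z* y. Then K̃⁻¹ y = σₙ^{−2} (y − σ_f² Z W w). -/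
open Matrix
open scoped ComplexOrder

/-- Training vector formula: with `K̃ = σ_f² Z W Z* + σₙ² Iₙ` and
`w = W⁻¹ (σ_f² Z* Z + σₙ² W⁻¹)⁻¹ Z* y`, we have `K̃⁻¹ y = σₙ⁻² (y - σ_f² Z W w)`. -/
theorem inv_kernel_mulVec_eq
    (n s : ℕ) (hn : 1 ≤ n) (hs : 1 ≤ s)
    (Z : Matrix (Fin n) (Fin s) ℂ) (w : Fin s → ℝ) (hw : ∀ i, 0 < w i)
    (σf σn : ℝ) (hσf : 0 < σf) (hσn : 0 < σn) (y : Fin n → ℂ)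
    (W : Matrix (Fin s) (Fin s) ℂ) (hW : W = Matrix.diagonal fun i => (w i : ℂ))
    (K : Matrix (Fin n) (Fin n) ℂ)
    (hK : K = ((σf : ℂ) ^ 2) • (Z * W * Zᴴ) + ((σn : ℂ) ^ 2) • 1)
    (wv : Fin s → ℂ)
    (hwv : wv = (W⁻¹ * (((σf : ℂ) ^ 2) • (Zᴴ * Z) + ((σn : ℂ) ^ 2) • W⁻¹)⁻¹).mulVec
        (Zᴴ.mulVec y)) :
    K⁻¹.mulVec y = (((σn : ℂ) ^ 2)⁻¹) • (y - ((σf : ℂ) ^ 2) • (Z * W).mulVec wv) := by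
  have hWp : W.PosDef := by
    rw [hW, Matrix.posDef_diagonal_iff]
    intro i
    exact_mod_cast hw i
  have hb : (0 : ℂ) < (σn : ℂ) ^ 2 := by exact_mod_cast pow_pos hσn 2
  have ha : (0 : ℂ) ≤ (σf : ℂ) ^ 2 := by exact_mod_cast (pow_pos hσf 2).le
  have hWu : IsUnit W.det := (Matrix.isUnit_iff_isUnit_det _).1 hWp.isUnit
  have hMp : (((σf : ℂ) ^ 2) • (Zᴴ * Z) + ((σn : ℂ) ^ 2) • W⁻¹).PosDef :=
    Matrix.PosDef.posSemidef_add ((Matrix.posSemidef_conjTranspose_mul_self Z).smul ha)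
      (hWp.inv.smul hb)
  generalize hM : ((σf : ℂ) ^ 2) • (Zᴴ * Z) + ((σn : ℂ) ^ 2) • W⁻¹ = M at hMp hwv
  have hMu : IsUnit M.det := (Matrix.isUnit_iff_isUnit_det _).1 hMp.isUnit
  have hb0 : (σn : ℂ) ^ 2 ≠ 0 := hb.ne'
  generalize (σn : ℂ) ^ 2 = b at *
  generalize (σf : ℂ) ^ 2 = a at *
  have hKZ : K * Z = Z * W * M := by
    rw [hK, ← hM, Matrix.add_mul, Matrix.mul_add, Matrix.mul_smul, Matrix.mul_smul,
      Matrix.mul_assoc Z W W⁻¹, Matrix.mul_nonsing_inv _ hWu]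
    simp [Matrix.mul_assoc]
  have hKinv : K⁻¹ = b⁻¹ • (1 - a • (Z * M⁻¹ * Zᴴ)) := by
    apply Matrix.inv_eq_right_inv
    have h : K * (Z * M⁻¹ * Zᴴ) = Z * W * Zᴴ := by
      rw [← Matrix.mul_assoc, ← Matrix.mul_assoc, hKZ, Matrix.mul_assoc (Z * W) M,
        Matrix.mul_nonsing_inv _ hMu, Matrix.mul_one]
    rw [Matrix.mul_smul, Matrix.mul_sub, Matrix.mul_smul, h, Matrix.mul_one, hK,
      add_sub_cancel_left, smul_smul, inv_mul_cancel₀ hb0, one_smul]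
  have hv : (Z * W).mulVec wv = (Z * M⁻¹ * Zᴴ).mulVec y := by
    rw [hwv, Matrix.mulVec_mulVec, Matrix.mulVec_mulVec, ← Matrix.mul_assoc (Z * W),
      Matrix.mul_assoc Z W W⁻¹, Matrix.mul_nonsing_inv _ hWu, Matrix.mul_one]
  rw [hKinv, hv, Matrix.smul_mulVec, Matrix.sub_mulVec, Matrix.smul_mulVec, Matrix.one_mulVec]
end

section
/- Let n, s ≥ 1 be integers, let Z be an n×s complex matrix, let W be an s×s diagonal matrix with positive real diagonal entries, and let σ_f, σₙ > 0. Define K̃ := σ_f² Z W Z* + σₙ² Iₙ and F := σ_f² (σ_f² Z* Z + σₙ² W⁻¹)⁻¹ Z* Z. Then Tr(K̃⁻¹ · Z W Z*) = σ_f^{−2} · Tr(F). -/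
open Matrix
open scoped ComplexOrder

/-- Trace identity for the `σ_f²`-derivative: with `K̃ = σ_f² Z W Z* + σₙ² Iₙ` and
`F = σ_f² (σ_f² Z* Z + σₙ² W⁻¹)⁻¹ Z* Z`, we have `Tr(K̃⁻¹ Z W Z*) = σ_f⁻² Tr F`. -/
theorem trace_inv_kernel_mul_low_rank
    (n s : ℕ) (hn : 1 ≤ n) (hs : 1 ≤ s)
    (Z : Matrix (Fin n) (Fin s) ℂ) (w : Fin s → ℝ) (hw : ∀ i, 0 < w i)
    (σf σn : ℝ) (hσf : 0 < σf) (hσn : 0 < σn)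
    (W : Matrix (Fin s) (Fin s) ℂ) (hW : W = Matrix.diagonal fun i => (w i : ℂ))
    (K : Matrix (Fin n) (Fin n) ℂ)
    (hK : K = ((σf : ℂ) ^ 2) • (Z * W * Zᴴ) + ((σn : ℂ) ^ 2) • 1)
    (F : Matrix (Fin s) (Fin s) ℂ)
    (hF : F = ((σf : ℂ) ^ 2) •
        ((((σf : ℂ) ^ 2) • (Zᴴ * Z) + ((σn : ℂ) ^ 2) • W⁻¹)⁻¹ * (Zᴴ * Z))) :
    (K⁻¹ * (Z * W * Zᴴ)).trace = (((σf : ℂ) ^ 2)⁻¹) * F.trace := by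
  have hf : (0 : ℂ) < (σf : ℂ) ^ 2 := by
    have : (0 : ℝ) < σf ^ 2 := by positivity
    exact_mod_cast this
  have hn' : (0 : ℂ) < (σn : ℂ) ^ 2 := by
    have : (0 : ℝ) < σn ^ 2 := by positivity
    exact_mod_cast this
  have hWp : W.PosDef := by
    rw [hW]
    refine Matrix.PosDef.diagonal ?_
    intro i
    exact_mod_cast hw i
  have hWd : IsUnit W.det := (Matrix.isUnit_iff_isUnit_det _).1 hWp.isUnit
  have hKp : K.PosDef := by
    rw [hK]
    exact Matrix.PosDef.posSemidef_add
      ((hWp.posSemidef.mul_mul_conjTranspose_same Z).smul hf.le) (Matrix.PosDef.one.smul hn')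
  have hKd : IsUnit K.det := (Matrix.isUnit_iff_isUnit_det _).1 hKp.isUnit
  obtain ⟨A, hA⟩ : ∃ A, A = ((σf : ℂ) ^ 2) • (Zᴴ * Z) + ((σn : ℂ) ^ 2) • W⁻¹ := ⟨_, rfl⟩
  have hAp : A.PosDef := by
    rw [hA]
    exact Matrix.PosDef.posSemidef_add
      ((Matrix.posSemidef_conjTranspose_mul_self Z).smul hf.le) (hWp.inv.smul hn')
  have hAd : IsUnit A.det := (Matrix.isUnit_iff_isUnit_det _).1 hAp.isUnit
  have key : K * Z = Z * W * A := by
    rw [hK, hA, Matrix.add_mul, Matrix.mul_add, Matrix.smul_mul, Matrix.smul_mul, Matrix.mul_smul,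
      Matrix.mul_smul, Matrix.mul_assoc Z W W⁻¹, Matrix.mul_nonsing_inv _ hWd]
    simp only [Matrix.mul_assoc, Matrix.one_mul, Matrix.mul_one]
  have key2 : K⁻¹ * (Z * W) = Z * A⁻¹ := by
    calc K⁻¹ * (Z * W) = K⁻¹ * (Z * W * A * A⁻¹) := by
          rw [Matrix.mul_nonsing_inv_cancel_right _ _ hAd]
      _ = Z * A⁻¹ := by
          rw [← key, Matrix.mul_assoc, Matrix.nonsing_inv_mul_cancel_left _ _ hKd]
  rw [hF, ← hA, Matrix.trace_smul, smul_eq_mul, inv_mul_cancel_left₀ hf.ne',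
    ← Matrix.mul_assoc, key2, Matrix.mul_assoc, Matrix.trace_mul_comm, Matrix.mul_assoc]
end

section
/- Let n, s ≥ 1 be integers, let Z be an n×s complex matrix, let W be an s×s diagonal matrix with positive real diagonal entries, let σ_f, σₙ > 0, and let D be an arbitrary s×s complex matrix. Define K̃ := σ_f² Z W Z* + σₙ² Iₙ and F := σ_f² (σ_f² Z* Z + σₙ² W⁻¹)⁻¹ Z* Z. Then Tr(K̃⁻¹ · σ_f² Z D Z*) = σₙ^{−2} σ_f² · ( Tr(D · Z* Z) − Tr(D · Z* Z · F) ). -/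
open Matrix
open scoped ComplexOrder

/-- Trace identity for hyperparameter derivatives: with `K̃ = σ_f² Z W Z* + σₙ² Iₙ`,
`F = σ_f² (σ_f² Z* Z + σₙ² W⁻¹)⁻¹ Z* Z`, and any `s × s` complex matrix `D`,
`Tr(K̃⁻¹ σ_f² Z D Z*) = σₙ⁻² σ_f² (Tr(D Z* Z) - Tr(D Z* Z F))`. -/
theorem trace_inv_kernel_mul_deriv
    (n s : ℕ) (hn : 1 ≤ n) (hs : 1 ≤ s)
    (Z : Matrix (Fin n) (Fin s) ℂ) (w : Fin s → ℝ) (hw : ∀ i, 0 < w i)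
    (σf σn : ℝ) (hσf : 0 < σf) (hσn : 0 < σn)
    (W : Matrix (Fin s) (Fin s) ℂ) (hW : W = Matrix.diagonal fun i => (w i : ℂ))
    (D : Matrix (Fin s) (Fin s) ℂ)
    (K : Matrix (Fin n) (Fin n) ℂ)
    (hK : K = ((σf : ℂ) ^ 2) • (Z * W * Zᴴ) + ((σn : ℂ) ^ 2) • 1)
    (F : Matrix (Fin s) (Fin s) ℂ)
    (hF : F = ((σf : ℂ) ^ 2) •
        ((((σf : ℂ) ^ 2) • (Zᴴ * Z) + ((σn : ℂ) ^ 2) • W⁻¹)⁻¹ * (Zᴴ * Z))) :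
    (K⁻¹ * (((σf : ℂ) ^ 2) • (Z * D * Zᴴ))).trace
      = (((σn : ℂ) ^ 2)⁻¹) * ((σf : ℂ) ^ 2)
          * ((D * (Zᴴ * Z)).trace - (D * (Zᴴ * Z) * F).trace) := by
  have ha : (0:ℂ) < (σf : ℂ) ^ 2 := by
    have : (0:ℝ) < σf ^ 2 := by positivity
    exact_mod_cast this
  have hb : (0:ℂ) < (σn : ℂ) ^ 2 := by
    have : (0:ℝ) < σn ^ 2 := by positivity
    exact_mod_cast this
  have hWp : W.PosDef := by
    rw [hW]
    exact Matrix.PosDef.diagonal (fun i => by exact_mod_cast hw i)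
  generalize (σf : ℂ) ^ 2 = a at *
  generalize (σn : ℂ) ^ 2 = b at *
  have hM : (a • (Zᴴ * Z) + b • W⁻¹).PosDef :=
    Matrix.PosDef.posSemidef_add
      ((Matrix.posSemidef_conjTranspose_mul_self Z).smul ha.le) (hWp.inv.smul hb)
  have hMu := (Matrix.isUnit_iff_isUnit_det _).1 hM.isUnit
  have hWu := (Matrix.isUnit_iff_isUnit_det _).1 hWp.isUnit
  have hWM : W * (a • (Zᴴ * Z) + b • W⁻¹) = a • (W * (Zᴴ * Z)) + b • 1 := by
    rw [Matrix.mul_add, Matrix.mul_smul, Matrix.mul_smul, Matrix.mul_nonsing_inv _ hWu]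
  generalize a • (Zᴴ * Z) + b • W⁻¹ = M at *
  have hKM : K * (Z * M⁻¹ * Zᴴ) = Z * W * Zᴴ := by
    have h1 : K * Z = Z * W * M := by
      rw [hK, Matrix.mul_assoc Z W M, hWM]
      simp [Matrix.add_mul, Matrix.mul_add, Matrix.mul_assoc]
    rw [← Matrix.mul_assoc, ← Matrix.mul_assoc, h1, Matrix.mul_nonsing_inv_cancel_right _ _ hMu]
  have hKi : K⁻¹ = b⁻¹ • (1 - a • (Z * M⁻¹ * Zᴴ)) := by
    apply Matrix.inv_eq_right_inv
    rw [Matrix.mul_smul, Matrix.mul_sub, Matrix.mul_smul, hKM, hK, Matrix.mul_one,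
      add_sub_cancel_left, smul_smul, inv_mul_cancel₀ hb.ne', one_smul]
  have t1 : (Z * D * Zᴴ).trace = (D * (Zᴴ * Z)).trace := by
    rw [Matrix.mul_assoc, Matrix.trace_mul_comm, Matrix.mul_assoc]
  have t2 : (Z * M⁻¹ * Zᴴ * (Z * D * Zᴴ)).trace = (D * (Zᴴ * Z) * (M⁻¹ * (Zᴴ * Z))).trace := by
    rw [Matrix.trace_mul_comm]
    have : Z * D * Zᴴ * (Z * M⁻¹ * Zᴴ) = Z * (D * (Zᴴ * Z) * M⁻¹ * Zᴴ) := by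
      simp only [Matrix.mul_assoc]
    rw [this, Matrix.trace_mul_comm]
    simp only [Matrix.mul_assoc]
  rw [hKi, hF]
  simp only [Matrix.smul_mul, Matrix.mul_smul, Matrix.sub_mul, Matrix.one_mul,
    Matrix.trace_smul, Matrix.trace_sub, t1, t2, smul_eq_mul]
  ring
end
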